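/- arXiv:math/0610980 — 2 statements merged into one kernel-verified Lean document; each statement's English description precedes it below -/
import Mathlib

section
/- Let Γ be a finite connected triangle-free simplicial graph with at least two edges, let φ ∈ Aut⁰(A_Γ) be a pure automorphism, and let J = U * W be a maximal join in Γ. Then φ maps A_J = F⟨U⟩ × F⟨W⟩ to a conjugate of itself: φ(A_J) = g A_J g⁻¹ for some g ∈ A_Γ. Moreover, if U contains no leaves of Γ, then φ(F⟨U⟩) is conjugate to F⟨U⟩ (the factor F⟨U⟩ is preserved up to conjugacy). -/
noncomputable section

/-! ### Outer automorphism groups -/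

/-- The subgroup of inner automorphisms of `G` inside `MulAut G`. -/
def Inn (G : Type*) [Group G] : Subgroup (MulAut G) := (MulAut.conj : G →* MulAut G).range

instance Inn.normal (G : Type*) [Group G] : (Inn G).Normal := by
  constructor
  intro n hn φ
  obtain ⟨g, rfl⟩ := hn
  refine ⟨φ g, ?_⟩
  ext x
  simp [MulAut.conj_apply, MulAut.mul_apply, map_mul, map_inv, mul_assoc]

/-- The outer automorphism group of `G`. -/
abbrev Out (G : Type*) [Group G] := MulAut G ⧸ Inn G

/-! ### Right-angled Artin groups -/

variable {V : Type*}

/-- The commutator relations defining a right-angled Artin group. -/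
def raagRels (Γ : SimpleGraph V) : Set (FreeGroup V) :=
  {r | ∃ v w : V, Γ.Adj v w ∧
    r = FreeGroup.of v * FreeGroup.of w * (FreeGroup.of v)⁻¹ * (FreeGroup.of w)⁻¹}

/-- The right-angled Artin group associated to a simple graph. -/
abbrev RAAG (Γ : SimpleGraph V) := PresentedGroup (raagRels Γ)

/-- The generator of `RAAG Γ` corresponding to a vertex. -/
def raagGen (Γ : SimpleGraph V) (v : V) : RAAG Γ := PresentedGroup.of v

/-- The special subgroup generated by the vertices in `Θ`. -/
def SpecialSubgroup (Γ : SimpleGraph V) (Θ : Set V) : Subgroup (RAAG Γ) :=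
  Subgroup.closure (raagGen Γ '' Θ)

/-! ### Graph-theoretic notions -/

/-- The link of a vertex. -/
def lk (Γ : SimpleGraph V) (v : V) : Set V := Γ.neighborSet v

/-- The (closed) star of a vertex. -/
def starOf (Γ : SimpleGraph V) (v : V) : Set V := insert v (Γ.neighborSet v)

/-- `Θ⊥`: the intersection of the closed stars of the vertices of `Θ`. -/
def perp (Γ : SimpleGraph V) (Θ : Set V) : Set V := ⋂ v ∈ Θ, starOf Γ v

/-- A leaf is a vertex of valence one. -/
def IsLeaf (Γ : SimpleGraph V) (v : V) : Prop := ∃ w, Γ.neighborSet v = {w}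

/-- The vertex set of the maximal join `J_v = L_v * L_v⊥` associated to a vertex `v`. -/
def JoinOf (Γ : SimpleGraph V) (v : V) : Set V := lk Γ v ∪ perp Γ (lk Γ v)

/-- A vertex is cyclic if `L_v⊥ = {v}`. -/
def IsCyclicVertex (Γ : SimpleGraph V) (v : V) : Prop := perp Γ (lk Γ v) = {v}

/-- `C` is a connected component of the full subgraph of `Γ` spanned by `S`. -/
def IsComponentOf (Γ : SimpleGraph V) (S C : Set V) : Prop :=
  C ⊆ S ∧ C.Nonempty ∧ (Γ.induce C).Connected ∧
    ∀ x ∈ C, ∀ y ∈ S, Γ.Adj x y → y ∈ C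

/-- A separating vertex: `Γ − {v}` is disconnected. -/
def IsSeparating (Γ : SimpleGraph V) (v : V) : Prop :=
  Set.Nonempty ({v}ᶜ : Set V) ∧ ¬ (Γ.induce ({v}ᶜ : Set V)).Connected

/-- `δ_C(v)`: the number of connected components of `Γ − {v}`. -/
noncomputable def deltaC (Γ : SimpleGraph V) (v : V) : ℕ :=
  {C : Set V | IsComponentOf Γ ({v}ᶜ : Set V) C}.ncard

/-- `ℓ(v)`: the number of leaves adjacent to `v`. -/
noncomputable def nAdjLeaves (Γ : SimpleGraph V) (v : V) : ℕ :=
  {w : V | Γ.Adj v w ∧ IsLeaf Γ w}.ncard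

/-- A twig at `v`: a non-singleton component of `Γ − {v}` contained in the ball of
radius 2 about `v` (as a metric space, so every edge must have an endpoint adjacent
to `v`). -/
def IsTwigOf (Γ : SimpleGraph V) (v : V) (C : Set V) : Prop :=
  IsComponentOf Γ ({v}ᶜ : Set V) C ∧ (¬ ∃ w, C = {w}) ∧
  (∀ x ∈ C, Γ.dist v x ≤ 2) ∧
  ∀ x ∈ C, ∀ y ∈ C, Γ.Adj x y → (Γ.Adj v x ∨ Γ.Adj v y)

/-- `τ(v)`: the number of twigs at `v`. -/
noncomputable def nTwigs (Γ : SimpleGraph V) (v : V) : ℕ := {C : Set V | IsTwigOf Γ v C}.ncard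

/-- `Γ` is the star `{v} * W`. -/
def IsStarGraph (Γ : SimpleGraph V) (v : V) : Prop :=
  ∀ x y, Γ.Adj x y ↔ (x = v ∧ y ≠ v) ∨ (y = v ∧ x ≠ v)

/-- The link-equivalence class of `v` is maximal. -/
def HasMaximalLink (Γ : SimpleGraph V) (v : V) : Prop :=
  ∀ w, lk Γ v ⊆ lk Γ w → lk Γ w = lk Γ v

/-- `V0` is a set of representatives, one from each maximal link-equivalence class
(with the convention `V0 = {v}` when `Γ` is a star `{v} * W`). -/
def IsV0 (Γ : SimpleGraph V) (V0 : Set V) : Prop :=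
  (∃ v, IsStarGraph Γ v ∧ V0 = {v}) ∨
  ((¬ ∃ v, IsStarGraph Γ v) ∧
    (∀ v ∈ V0, HasMaximalLink Γ v) ∧
    (∀ v ∈ V0, ∀ w ∈ V0, lk Γ v = lk Γ w → v = w) ∧
    (∀ w, HasMaximalLink Γ w → ∃ v ∈ V0, lk Γ v = lk Γ w))

/-- A join `U * W` (as a full subgraph of `Γ`): a complete bipartite full subgraph. -/
def IsJoin (Γ : SimpleGraph V) (U W : Set V) : Prop :=
  U.Nonempty ∧ W.Nonempty ∧ Disjoint U W ∧
  (∀ u ∈ U, ∀ w ∈ W, Γ.Adj u w) ∧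
  (∀ u ∈ U, ∀ u' ∈ U, ¬ Γ.Adj u u') ∧
  (∀ w ∈ W, ∀ w' ∈ W, ¬ Γ.Adj w w')

/-- A maximal join: a join not properly contained in any other join subgraph. -/
def IsMaximalJoin (Γ : SimpleGraph V) (U W : Set V) : Prop :=
  IsJoin Γ U W ∧ ∀ U' W', IsJoin Γ U' W' → U ∪ W ⊆ U' ∪ W' → U ∪ W = U' ∪ W'

/-! ### Generating automorphisms and `Aut⁰`, `Out⁰` -/

/-- `φ` is the inversion at the vertex `v`. -/
def IsInversionAt (Γ : SimpleGraph V) (φ : MulAut (RAAG Γ)) (v : V) : Prop :=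
  φ (raagGen Γ v) = (raagGen Γ v)⁻¹ ∧ ∀ w, w ≠ v → φ (raagGen Γ w) = raagGen Γ w

/-- `φ` conjugates the generators in `C` by `v` and fixes all other generators. -/
def IsPartialConjBy (Γ : SimpleGraph V) (φ : MulAut (RAAG Γ)) (v : V) (C : Set V) : Prop :=
  (∀ x ∈ C, φ (raagGen Γ x) = (raagGen Γ v)⁻¹ * raagGen Γ x * raagGen Γ v) ∧
  (∀ x, x ∉ C → φ (raagGen Γ x) = raagGen Γ x)

/-- `φ` is the (right) transvection `w ↦ wv` (defined when `st(v) ⊇ lk(w)`). -/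
def IsTransvection (Γ : SimpleGraph V) (φ : MulAut (RAAG Γ)) (w v : V) : Prop :=
  v ≠ w ∧ lk Γ w ⊆ starOf Γ v ∧
  φ (raagGen Γ w) = raagGen Γ w * raagGen Γ v ∧
  ∀ x, x ≠ w → φ (raagGen Γ x) = raagGen Γ x

/-- The group of pure automorphisms `Aut⁰(A_Γ)`. -/
def Aut0 (Γ : SimpleGraph V) : Subgroup (MulAut (RAAG Γ)) :=
  Subgroup.closure
    ({φ | φ ∈ Inn (RAAG Γ)} ∪ {φ | ∃ v, IsInversionAt Γ φ v} ∪
     {φ | ∃ v C, IsComponentOf Γ ((starOf Γ v)ᶜ) C ∧ IsPartialConjBy Γ φ v C} ∪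
     {φ | ∃ w v, IsTransvection Γ φ w v})

/-- The group of pure outer automorphisms `Out⁰(A_Γ)`. -/
def Out0 (Γ : SimpleGraph V) : Subgroup (Out (RAAG Γ)) :=
  (Aut0 Γ).map (QuotientGroup.mk' (Inn (RAAG Γ)))


section PreservedSubgroups

/-! ### Automorphisms preserving a subgroup up to conjugacy -/

/-- The automorphisms of `G` mapping `H` to a conjugate of itself. -/
def conjClassStabilizer {G : Type*} [Group G] (H : Subgroup G) : Subgroup (MulAut G) where
  carrier := {φ | ∃ g : G, H.map φ.toMonoidHom = H.map (MulAut.conj g).toMonoidHom}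
  one_mem' := ⟨1, by rw [map_one]⟩
  mul_mem' := by
    rintro φ ψ ⟨g, hg⟩ ⟨h, hh⟩
    refine ⟨φ h * g, ?_⟩
    have h1 : (φ * ψ).toMonoidHom = φ.toMonoidHom.comp ψ.toMonoidHom := rfl
    have h2 : φ.toMonoidHom.comp (MulAut.conj h).toMonoidHom
        = (MulAut.conj (φ h)).toMonoidHom.comp φ.toMonoidHom := by
      ext x; simp
    have h3 : (MulAut.conj (φ h * g)).toMonoidHom
        = (MulAut.conj (φ h)).toMonoidHom.comp (MulAut.conj g).toMonoidHom := by
      rw [map_mul]; rfl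
    rw [h1, ← Subgroup.map_map, hh, Subgroup.map_map, h2, ← Subgroup.map_map, hg,
      Subgroup.map_map, h3]
  inv_mem' := by
    rintro φ ⟨g, hg⟩
    refine ⟨φ⁻¹ g⁻¹, ?_⟩
    have h1 : (MulAut.conj (φ⁻¹ g⁻¹)).toMonoidHom
        = ((φ⁻¹).toMonoidHom.comp (MulAut.conj g⁻¹).toMonoidHom).comp φ.toMonoidHom := by
      ext x; simp
    have h2 : (MulAut.conj g⁻¹).toMonoidHom.comp (MulAut.conj g).toMonoidHom
        = MonoidHom.id G := by
      ext x; simp [mul_assoc]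
    rw [h1, ← Subgroup.map_map, hg, Subgroup.map_map, MonoidHom.comp_assoc, h2,
      MonoidHom.comp_id]

lemma Inn_le_conjClassStabilizer {G : Type*} [Group G] (H : Subgroup G) :
    Inn G ≤ conjClassStabilizer H := by
  rintro _ ⟨g, rfl⟩
  exact ⟨g, rfl⟩

variable {Γ : SimpleGraph V} {φ : MulAut (RAAG Γ)} {U W Θ C : Set V} {v w : V}

lemma raagGen_mem_specialSubgroup (h : v ∈ Θ) : raagGen Γ v ∈ SpecialSubgroup Γ Θ :=
  Subgroup.subset_closure ⟨v, h, rfl⟩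

lemma mem_conjClassStabilizer_of_forall_eq_conj (g : RAAG Γ)
    (h : ∀ x ∈ Θ, φ (raagGen Γ x) = g * raagGen Γ x * g⁻¹) :
    φ ∈ conjClassStabilizer (SpecialSubgroup Γ Θ) := by
  refine ⟨g, ?_⟩
  simp only [SpecialSubgroup, MonoidHom.map_closure]
  congr 1
  ext y
  simp only [Set.mem_image]
  constructor
  · rintro ⟨_, ⟨x, hx, rfl⟩, rfl⟩
    exact ⟨_, ⟨x, hx, rfl⟩, (h x hx).symm⟩
  · rintro ⟨_, ⟨x, hx, rfl⟩, rfl⟩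
    exact ⟨_, ⟨x, hx, rfl⟩, h x hx⟩

lemma mem_conjClassStabilizer_of_forall_fixed
    (h : ∀ x ∈ Θ, φ (raagGen Γ x) = raagGen Γ x) :
    φ ∈ conjClassStabilizer (SpecialSubgroup Γ Θ) :=
  mem_conjClassStabilizer_of_forall_eq_conj 1 fun x hx => by simp [h x hx]

lemma mem_conjClassStabilizer_of_forall_mem
    (h : ∀ x ∈ Θ, φ (raagGen Γ x) ∈ SpecialSubgroup Γ Θ)
    (h' : ∀ x ∈ Θ, raagGen Γ x ∈ (SpecialSubgroup Γ Θ).map φ.toMonoidHom) :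
    φ ∈ conjClassStabilizer (SpecialSubgroup Γ Θ) := by
  refine ⟨1, ?_⟩
  have h1 : (SpecialSubgroup Γ Θ).map (MulAut.conj (1 : RAAG Γ)).toMonoidHom
      = SpecialSubgroup Γ Θ := by
    rw [map_one]
    exact Subgroup.map_id _
  rw [h1]
  apply le_antisymm
  · rw [Subgroup.map_le_iff_le_comap, SpecialSubgroup, Subgroup.closure_le]
    rintro _ ⟨x, hx, rfl⟩
    exact h x hx
  · conv_lhs => rw [SpecialSubgroup]
    rw [Subgroup.closure_le]
    rintro _ ⟨x, hx, rfl⟩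
    exact h' x hx

lemma raagGen_mem_map_of_fixed (hw : w ∈ Θ) (h : φ (raagGen Γ w) = raagGen Γ w) :
    raagGen Γ w ∈ (SpecialSubgroup Γ Θ).map φ.toMonoidHom :=
  ⟨_, raagGen_mem_specialSubgroup hw, h⟩

lemma raagGen_commute (h : Γ.Adj v w) : raagGen Γ v * raagGen Γ w = raagGen Γ w * raagGen Γ v := by
  have h1 : (PresentedGroup.mk (raagRels Γ)) (FreeGroup.of v * FreeGroup.of w *
      (FreeGroup.of v)⁻¹ * (FreeGroup.of w)⁻¹) = 1 :=
    PresentedGroup.one_of_mem ⟨v, w, h, rfl⟩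
  simp only [map_mul, map_inv] at h1
  rw [mul_inv_eq_one, mul_inv_eq_iff_eq_mul] at h1
  exact h1

/-! ### Generators of `Aut⁰` -/

lemma IsInversionAt.mem_conjClassStabilizer (h : IsInversionAt Γ φ v) (Θ : Set V) :
    φ ∈ conjClassStabilizer (SpecialSubgroup Γ Θ) := by
  refine mem_conjClassStabilizer_of_forall_mem (fun x hx => ?_) (fun x hx => ?_)
  · rcases eq_or_ne x v with rfl | hxv
    · rw [h.1]; exact inv_mem (raagGen_mem_specialSubgroup hx)
    · rw [h.2 x hxv]; exact raagGen_mem_specialSubgroup hx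
  · rcases eq_or_ne x v with rfl | hxv
    · refine ⟨(raagGen Γ x)⁻¹, inv_mem (raagGen_mem_specialSubgroup hx), ?_⟩
      simp [h.1]
    · exact raagGen_mem_map_of_fixed hx (h.2 x hxv)

lemma IsTransvection.mem_conjClassStabilizer (h : IsTransvection Γ φ w v)
    (hv : w ∈ Θ → v ∈ Θ) : φ ∈ conjClassStabilizer (SpecialSubgroup Γ Θ) := by
  obtain ⟨hvw, -, h1, h2⟩ := h
  by_cases hw : w ∈ Θ
  · have hvΘ := raagGen_mem_specialSubgroup (Γ := Γ) (hv hw)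
    have hwΘ := raagGen_mem_specialSubgroup (Γ := Γ) hw
    refine mem_conjClassStabilizer_of_forall_mem (fun x hx => ?_) (fun x hx => ?_)
    · rcases eq_or_ne x w with rfl | hxw
      · rw [h1]; exact mul_mem hwΘ hvΘ
      · rw [h2 x hxw]; exact raagGen_mem_specialSubgroup hx
    · rcases eq_or_ne x w with rfl | hxw
      · refine ⟨raagGen Γ x * (raagGen Γ v)⁻¹, mul_mem hwΘ (inv_mem hvΘ), ?_⟩
        simp [h1, h2 v hvw]
      · exact raagGen_mem_map_of_fixed hx (h2 x hxw)
  · exact mem_conjClassStabilizer_of_forall_fixed fun x hx =>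
      h2 x fun hxw => hw (hxw ▸ hx)

lemma IsPartialConjBy.mem_conjClassStabilizer_of_mem (hC : C ⊆ (starOf Γ v)ᶜ)
    (h : IsPartialConjBy Γ φ v C) (hv : v ∈ Θ) :
    φ ∈ conjClassStabilizer (SpecialSubgroup Γ Θ) := by
  have hvΘ := raagGen_mem_specialSubgroup (Γ := Γ) hv
  have hvC : v ∉ C := fun hvC => hC hvC (Set.mem_insert v _)
  refine mem_conjClassStabilizer_of_forall_mem (fun x hx => ?_) (fun x hx => ?_)
  · have hxΘ := raagGen_mem_specialSubgroup (Γ := Γ) hx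
    by_cases hxC : x ∈ C
    · rw [h.1 x hxC]; exact mul_mem (mul_mem (inv_mem hvΘ) hxΘ) hvΘ
    · rwa [h.2 x hxC]
  · have hxΘ := raagGen_mem_specialSubgroup (Γ := Γ) hx
    by_cases hxC : x ∈ C
    · refine ⟨raagGen Γ v * raagGen Γ x * (raagGen Γ v)⁻¹,
        mul_mem (mul_mem hvΘ hxΘ) (inv_mem hvΘ), ?_⟩
      simp [h.1 x hxC, h.2 v hvC, mul_assoc]
    · exact raagGen_mem_map_of_fixed hx (h.2 x hxC)

/-- A partial conjugation acts as a conjugation on `A_Θ` if the component `C` contains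
`Θ − st(v)`. -/
lemma IsPartialConjBy.mem_conjClassStabilizer_of_subset (h : IsPartialConjBy Γ φ v C)
    (hΘ : Θ \ starOf Γ v ⊆ C) : φ ∈ conjClassStabilizer (SpecialSubgroup Γ Θ) := by
  refine mem_conjClassStabilizer_of_forall_eq_conj (raagGen Γ v)⁻¹ fun x hx => ?_
  rw [inv_inv]
  by_cases hxC : x ∈ C
  · exact h.1 x hxC
  · have hxv : x ∈ starOf Γ v := by
      by_contra hxv
      exact hxC (hΘ ⟨hx, hxv⟩)
    rw [h.2 x hxC]
    rcases hxv with rfl | hxv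
    · simp
    · rw [mul_assoc, ← raagGen_commute hxv, inv_mul_cancel_left]

/-! ### Maximal joins -/

lemma IsJoin.symm (h : IsJoin Γ U W) : IsJoin Γ W U := by
  obtain ⟨hU, hW, hd, hUW, hUU, hWW⟩ := h
  exact ⟨hW, hU, hd.symm, fun w hw u hu => (hUW u hu w hw).symm, hWW, hUU⟩

lemma IsMaximalJoin.symm (h : IsMaximalJoin Γ U W) : IsMaximalJoin Γ W U := by
  refine ⟨h.1.symm, ?_⟩
  rw [Set.union_comm W U]
  exact h.2

lemma SimpleGraph.CliqueFree.not_adj_of_adj_of_adj (htf : Γ.CliqueFree 3) {a b c : V}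
    (hab : Γ.Adj a b) (hac : Γ.Adj a c) : ¬ Γ.Adj b c := fun hbc => by
  classical
  exact htf {a, b, c} (SimpleGraph.is3Clique_triple_iff.2 ⟨hab, hac, hbc⟩)

/-- A vertex whose link contains one side of a maximal join belongs to the other side. -/
lemma IsMaximalJoin.mem_of_forall_adj (htf : Γ.CliqueFree 3) (hJ : IsMaximalJoin Γ U W)
    (hv : ∀ w ∈ W, Γ.Adj v w) : v ∈ U := by
  obtain ⟨⟨hU, hW, hd, hUW, hUU, hWW⟩, hmax⟩ := hJ
  obtain ⟨w₀, hw₀⟩ := hW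
  have hvW : v ∉ W := fun h => (hv v h).ne rfl
  have hvU : ∀ u ∈ U, ¬ Γ.Adj v u := fun u hu =>
    htf.not_adj_of_adj_of_adj (hv w₀ hw₀).symm (hUW u hu w₀ hw₀).symm
  have hJ' : IsJoin Γ (insert v U) W := by
    refine ⟨Set.insert_nonempty v U, ⟨w₀, hw₀⟩, Set.disjoint_insert_left.2 ⟨hvW, hd⟩, ?_, ?_, hWW⟩
    · rintro u (rfl | hu)
      exacts [hv, hUW u hu]
    · rintro u (rfl | hu) u' (rfl | hu')
      exacts [fun h => h.ne rfl, hvU u' hu', fun h => hvU u hu h.symm, hUU u hu u' hu']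
  have hmem : v ∈ U ∪ W := by
    rw [hmax _ _ hJ' (Set.union_subset_union_left W (Set.subset_insert v U))]
    exact Or.inl (Set.mem_insert v U)
  exact hmem.resolve_right hvW

lemma IsMaximalJoin.mem_of_lk_subset_starOf (htf : Γ.CliqueFree 3) (hJ : IsMaximalJoin Γ U W)
    (hw : w ∈ U) (h : lk Γ w ⊆ starOf Γ v) : v ∈ U ∪ W := by
  by_contra hv
  refine hv (Or.inl (hJ.mem_of_forall_adj htf fun x hx => ?_))
  rcases h (hJ.1.2.2.2.1 w hw x hx) with rfl | hxv
  exacts [absurd (Or.inr hx) hv, hxv]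

/-- Any maximal join not containing `v` has vertices outside `st(v)` on each side. -/
lemma IsMaximalJoin.exists_notMem_starOf (htf : Γ.CliqueFree 3) (hJ : IsMaximalJoin Γ U W)
    (hv : v ∉ U ∪ W) : ∃ w ∈ W, w ∉ starOf Γ v := by
  by_contra! h
  refine hv (Or.inl (hJ.mem_of_forall_adj htf fun w hw => ?_))
  rcases h w hw with rfl | hw'
  exacts [absurd (Or.inr hw) hv, hw']

lemma IsMaximalJoin.sdiff_starOf_subset_or_disjoint (htf : Γ.CliqueFree 3)
    (hJ : IsMaximalJoin Γ U W) (hv : v ∉ U ∪ W) (hC : IsComponentOf Γ (starOf Γ v)ᶜ C) :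
    (U ∪ W) \ starOf Γ v ⊆ C ∨ Disjoint (U ∪ W) C := by
  obtain ⟨w₀, hw₀, hw₀v⟩ := hJ.exists_notMem_starOf htf hv
  obtain ⟨u₀, hu₀, hu₀v⟩ := hJ.symm.exists_notMem_starOf htf (by rwa [Set.union_comm])
  obtain ⟨-, -, -, hUW, -, -⟩ := hJ.1
  obtain ⟨hCS, -, -, hadj⟩ := hC
  have hiff : ∀ x y, x ∉ starOf Γ v → y ∉ starOf Γ v → Γ.Adj x y → (x ∈ C ↔ y ∈ C) :=
    fun x y hx hy hxy => ⟨fun h => hadj x h y hy hxy, fun h => hadj y h x hx hxy.symm⟩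
  have key : ∀ x ∈ U ∪ W, x ∉ starOf Γ v → (x ∈ C ↔ w₀ ∈ C) := by
    rintro x (hx | hx) hxv
    · exact hiff x w₀ hxv hw₀v (hUW x hx w₀ hw₀)
    · exact (hiff u₀ x hu₀v hxv (hUW u₀ hu₀ x hx)).symm.trans
        (hiff u₀ w₀ hu₀v hw₀v (hUW u₀ hu₀ w₀ hw₀))
  by_cases hw₀C : w₀ ∈ C
  · exact Or.inl fun x hx => (key x hx.1 hx.2).2 hw₀C
  · exact Or.inr (Set.disjoint_left.2 fun x hx hxC => hw₀C ((key x hx (hCS hxC)).1 hxC))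

/-- Partial conjugations preserve up to conjugacy both the subgroup of a maximal join and
that of each of its sides. -/
lemma IsPartialConjBy.mem_conjClassStabilizer (h : IsPartialConjBy Γ φ v C)
    (htf : Γ.CliqueFree 3) (hJ : IsMaximalJoin Γ U W) (hC : IsComponentOf Γ (starOf Γ v)ᶜ C)
    (hΘ : Θ = U ∪ W ∨ Θ = U) : φ ∈ conjClassStabilizer (SpecialSubgroup Γ Θ) := by
  have hsub : Θ ⊆ U ∪ W := by
    rcases hΘ with rfl | rfl
    exacts [subset_rfl, Set.subset_union_left]
  by_cases hvΘ : v ∈ Θ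
  · exact h.mem_conjClassStabilizer_of_mem hC.1 hvΘ
  by_cases hv : v ∈ U ∪ W
  · have hΘU : Θ = U := hΘ.resolve_left fun h => hvΘ (h ▸ hv)
    subst hΘU
    refine mem_conjClassStabilizer_of_forall_fixed fun x hx => h.2 x fun hxC => ?_
    exact hC.1 hxC (Or.inr (hJ.1.2.2.2.1 x hx v (hv.resolve_left hvΘ)).symm)
  · rcases hJ.sdiff_starOf_subset_or_disjoint htf hv hC with hJC | hJC
    · exact h.mem_conjClassStabilizer_of_subset
        ((Set.sdiff_subset_sdiff_left hsub).trans hJC)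
    · exact mem_conjClassStabilizer_of_forall_fixed fun x hx =>
        h.2 x (Set.disjoint_left.1 hJC (hsub hx))

lemma Aut0_le_conjClassStabilizer (htf : Γ.CliqueFree 3) (hJ : IsMaximalJoin Γ U W)
    (hΘ : Θ = U ∪ W ∨ Θ = U)
    (htrans : ∀ w v, v ≠ w → lk Γ w ⊆ starOf Γ v → w ∈ Θ → v ∈ Θ) :
    Aut0 Γ ≤ conjClassStabilizer (SpecialSubgroup Γ Θ) := by
  rw [Aut0, Subgroup.closure_le]
  rintro φ (((h | ⟨v, h⟩) | ⟨v, C, hC, h⟩) | ⟨w, v, h⟩)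
  · exact Inn_le_conjClassStabilizer _ h
  · exact h.mem_conjClassStabilizer Θ
  · exact h.mem_conjClassStabilizer htf hJ hC hΘ
  · exact h.mem_conjClassStabilizer (htrans w v h.1 h.2.1)

end PreservedSubgroups

/-- Pure automorphisms preserve the special subgroups of maximal joins up to
conjugacy; if `U` has no leaves, the factor `F⟨U⟩` is also preserved up to
conjugacy. -/
theorem aut0_preserves_maximal_join {V : Type*} [Fintype V] (Γ : SimpleGraph V)
    (hconn : Γ.Connected) (htf : Γ.CliqueFree 3) (hE : 2 ≤ Γ.edgeSet.ncard)
    (φ : MulAut (RAAG Γ)) (hφ : φ ∈ Aut0 Γ)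
    (U W : Set V) (hJ : IsMaximalJoin Γ U W) :
    (∃ g : RAAG Γ, (SpecialSubgroup Γ (U ∪ W)).map φ.toMonoidHom
        = (SpecialSubgroup Γ (U ∪ W)).map (MulAut.conj g).toMonoidHom) ∧
    ((∀ u ∈ U, ¬ IsLeaf Γ u) →
      ∃ g : RAAG Γ, (SpecialSubgroup Γ U).map φ.toMonoidHom
        = (SpecialSubgroup Γ U).map (MulAut.conj g).toMonoidHom) := by
  refine ⟨Aut0_le_conjClassStabilizer htf hJ (Or.inl rfl) ?_ hφ, fun hleaf =>
    Aut0_le_conjClassStabilizer htf hJ (Or.inr rfl) ?_ hφ⟩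
  · rintro w v - hlk (hw | hw)
    · exact hJ.mem_of_lk_subset_starOf htf hw hlk
    · rw [Set.union_comm]
      exact hJ.symm.mem_of_lk_subset_starOf htf hw hlk
  · rintro w v - hlk hw
    by_contra hvU
    have hvW := (hJ.mem_of_lk_subset_starOf htf hw hlk).resolve_left hvU
    have hwv : Γ.Adj w v := hJ.1.2.2.2.1 w hw v hvW
    refine hleaf w hw ⟨v, Set.Subset.antisymm (fun x hx => ?_) (Set.singleton_subset_iff.2 hwv)⟩
    rcases hlk hx with rfl | hvx
    exacts [rfl, absurd hvx (htf.not_adj_of_adj_of_adj hwv hx)]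
end
end

section
/- Let Γ be a finite connected triangle-free simplicial graph with at least two edges, and let v, w be interior vertices of Γ joined by an edge. Suppose φ_v, φ_w ∈ Aut⁰(A_Γ) represent the same element of Out⁰(A_Γ), with φ_v(A_{J_v}) = A_{J_v} and φ_w(A_{J_w}) = A_{J_w}. Then there exist g_v ∈ A_{J_v} and g_w ∈ A_{J_w} such that c(g_v) ∘ φ_v = c(g_w) ∘ φ_w, where c(g) denotes conjugation by g. -/
noncomputable section

/-! ### Right-angled Artin groups -/

variable {V : Type*}

/-! ### Centralizers of generators of a free group -/

open Classical in
/-- An element of a free group commuting with a generator is a power of it. -/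
theorem FreeGroup.mem_zpowers_of_commute {α : Type*} (a : α) (x : FreeGroup α)
    (h : Commute x (FreeGroup.of a)) : x ∈ Subgroup.zpowers (FreeGroup.of a) := by
  induction hn : x.norm using Nat.strong_induction_on generalizing x with
  | _ n ih =>
  subst hn
  rcases hL : x.toWord with _ | ⟨⟨b, e⟩, L⟩
  · rw [FreeGroup.toWord_eq_nil_iff] at hL
    exact hL ▸ one_mem _
  · have hx : x = FreeGroup.mk [(b, e)] * FreeGroup.mk L := by
      rw [FreeGroup.mul_mk, ← FreeGroup.mk_toWord (x := x), hL]; rfl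
    by_cases hb : b = a
    · subst hb
      have hbe : FreeGroup.mk [(b, e)] ∈ Subgroup.zpowers (FreeGroup.of b) := by
        cases e
        · exact ⟨-1, by simp [FreeGroup.of, FreeGroup.inv_mk, FreeGroup.invRev]⟩
        · exact Subgroup.mem_zpowers _
      have hcomm : Commute (FreeGroup.mk [(b, e)]) (FreeGroup.of b) := by
        obtain ⟨k, hk⟩ := hbe
        rw [← hk]
        exact (Commute.refl _).zpow_left k
      have hL' : FreeGroup.mk L = (FreeGroup.mk [(b, e)])⁻¹ * x := by rw [hx]; group
      have hlt : (FreeGroup.mk L).norm < x.norm := by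
        refine lt_of_le_of_lt FreeGroup.norm_mk_le ?_
        rw [FreeGroup.norm, hL]; simp
      rw [hx]
      refine mul_mem hbe (ih _ hlt _ ?_ rfl)
      rw [hL']
      exact hcomm.inv_left.mul_left h
    · exfalso
      have h1 : (FreeGroup.of a * x).toWord = (a, true) :: (b, e) :: L := by
        rw [FreeGroup.toWord_mul, FreeGroup.toWord_of, List.singleton_append,
          FreeGroup.reduce.cons, FreeGroup.reduce_toWord, hL]
        simp [Ne.symm hb]
      have h2 := FreeGroup.toWord_mul_sublist x (FreeGroup.of a)
      rw [h.eq, h1, hL, FreeGroup.toWord_of] at h2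
      have h3 := h2.eq_of_length (by simp)
      simp only [List.cons_append, List.cons.injEq, Prod.mk.injEq] at h3
      exact hb h3.1.1.symm

/-- Conjugate generators of a free group are equal. -/
theorem FreeGroup.of_eq_of_mul_of_eq {α : Type*} {a b : α} {x : FreeGroup α}
    (h : x * FreeGroup.of b = FreeGroup.of a * x) : b = a := by
  classical
  by_contra hb
  have := congrArg (FreeGroup.lift fun c => Multiplicative.ofAdd (if c = a then (1 : ℤ) else 0)) h
  rw [_root_.map_mul, _root_.map_mul, mul_comm] at this
  have h' := mul_right_cancel this
  simp only [FreeGroup.lift_apply_of, hb, if_true, if_false] at h'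
  exact absurd (Multiplicative.ofAdd.injective h') (by norm_num)

/-! ### Homomorphisms out of a right-angled Artin group -/

theorem raagGen_commute_s6 {Γ : SimpleGraph V} {a b : V} (h : Γ.Adj a b) :
    Commute (raagGen Γ a) (raagGen Γ b) := by
  have : raagGen Γ a * raagGen Γ b * (raagGen Γ a)⁻¹ * (raagGen Γ b)⁻¹ = 1 :=
    PresentedGroup.one_of_mem (rels := raagRels Γ) ⟨a, b, h, rfl⟩
  rw [mul_inv_eq_one, mul_inv_eq_iff_eq_mul] at this
  exact this

theorem raagGen_commute_of_mem_starOf {Γ : SimpleGraph V} {a b : V} (h : b ∈ starOf Γ a) :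
    Commute (raagGen Γ a) (raagGen Γ b) := by
  rcases h with rfl | h
  · exact Commute.refl _
  · exact raagGen_commute_s6 h

/-- A map on vertices sending adjacent vertices to commuting elements extends to the
right-angled Artin group. -/
def RAAG.lift {G : Type*} [Group G] (Γ : SimpleGraph V) (f : V → G)
    (h : ∀ a b, Γ.Adj a b → Commute (f a) (f b)) : RAAG Γ →* G :=
  PresentedGroup.toGroup (f := f) (rels := raagRels Γ) (by
    rintro _ ⟨a, b, hab, rfl⟩
    simp [(h a b hab).eq])

@[simp]
theorem RAAG.lift_raagGen {G : Type*} [Group G] (Γ : SimpleGraph V) (f : V → G)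
    (h : ∀ a b, Γ.Adj a b → Commute (f a) (f b)) (a : V) :
    RAAG.lift Γ f h (raagGen Γ a) = f a :=
  PresentedGroup.toGroup.of _

theorem RAAG.hom_ext {G : Type*} [Group G] {Γ : SimpleGraph V} {f g : RAAG Γ →* G}
    (h : ∀ a, f (raagGen Γ a) = g (raagGen Γ a)) : f = g :=
  PresentedGroup.ext h

/-! ### Special subgroups -/

theorem raagGen_mem {Γ : SimpleGraph V} {Θ : Set V} {a : V} (h : a ∈ Θ) :
    raagGen Γ a ∈ SpecialSubgroup Γ Θ :=
  Subgroup.subset_closure ⟨a, h, rfl⟩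

theorem SpecialSubgroup.mono {Γ : SimpleGraph V} {S T : Set V} (h : S ⊆ T) :
    SpecialSubgroup Γ S ≤ SpecialSubgroup Γ T :=
  Subgroup.closure_mono (Set.image_mono h)

theorem SpecialSubgroup.univ (Γ : SimpleGraph V) : SpecialSubgroup Γ Set.univ = ⊤ := by
  rw [SpecialSubgroup, Set.image_univ]
  exact PresentedGroup.closure_range_of _

/-- The group endomorphism killing the vertices outside `Θ`. -/
def raagRetraction (Γ : SimpleGraph V) (Θ : Set V) : RAAG Γ →* RAAG Γ :=
  open Classical in
  RAAG.lift Γ (fun a => if a ∈ Θ then raagGen Γ a else 1) (by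
    intro a b hab
    by_cases ha : a ∈ Θ <;> by_cases hb : b ∈ Θ <;> simp [ha, hb, raagGen_commute_s6 hab])

theorem raagRetraction_of_mem {Γ : SimpleGraph V} {Θ : Set V} {a : V} (h : a ∈ Θ) :
    raagRetraction Γ Θ (raagGen Γ a) = raagGen Γ a := by
  simp [raagRetraction, h]

theorem raagRetraction_of_notMem {Γ : SimpleGraph V} {Θ : Set V} {a : V} (h : a ∉ Θ) :
    raagRetraction Γ Θ (raagGen Γ a) = 1 := by
  simp [raagRetraction, h]

theorem raagRetraction_eq_self {Γ : SimpleGraph V} {Θ : Set V} {x : RAAG Γ}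
    (h : x ∈ SpecialSubgroup Γ Θ) : raagRetraction Γ Θ x = x := by
  have : SpecialSubgroup Γ Θ ≤ (raagRetraction Γ Θ).eqLocus (MonoidHom.id _) := by
    rw [SpecialSubgroup, Subgroup.closure_le]
    rintro _ ⟨a, ha, rfl⟩
    exact raagRetraction_of_mem ha
  exact this h

theorem map_raagRetraction_le (Γ : SimpleGraph V) (S T : Set V) :
    (SpecialSubgroup Γ T).map (raagRetraction Γ S) ≤ SpecialSubgroup Γ (S ∩ T) := by
  rw [SpecialSubgroup, MonoidHom.map_closure, Subgroup.closure_le]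
  rintro _ ⟨_, ⟨a, ha, rfl⟩, rfl⟩
  by_cases hS : a ∈ S
  · rw [raagRetraction_of_mem hS]
    exact raagGen_mem ⟨hS, ha⟩
  · rw [raagRetraction_of_notMem hS]
    exact one_mem _

theorem raagRetraction_mem (Γ : SimpleGraph V) (Θ : Set V) (x : RAAG Γ) :
    raagRetraction Γ Θ x ∈ SpecialSubgroup Γ Θ := by
  have := map_raagRetraction_le Γ Θ Set.univ
  rw [SpecialSubgroup.univ, Set.inter_univ] at this
  exact this ⟨x, trivial, rfl⟩

theorem SpecialSubgroup.mem_inter {Γ : SimpleGraph V} {S T : Set V} {x : RAAG Γ}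
    (hS : x ∈ SpecialSubgroup Γ S) (hT : x ∈ SpecialSubgroup Γ T) :
    x ∈ SpecialSubgroup Γ (S ∩ T) :=
  map_raagRetraction_le Γ S T ⟨x, hT, raagRetraction_eq_self hS⟩

theorem SpecialSubgroup.mem_iInter {ι : Type*} {Γ : SimpleGraph V} {s : Set ι} (hs : s.Finite)
    {S : ι → Set V} {x : RAAG Γ} (h : ∀ i ∈ s, x ∈ SpecialSubgroup Γ (S i)) :
    x ∈ SpecialSubgroup Γ (⋂ i ∈ s, S i) := by
  induction s, hs using Set.Finite.induction_on with
  | empty => simp [SpecialSubgroup.univ]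
  | @insert a s _ _ ih =>
    rw [Set.biInter_insert]
    exact SpecialSubgroup.mem_inter (h a (Set.mem_insert a s))
      (ih fun i hi => h i (Set.mem_insert_of_mem a hi))

/-! ### Centralizers and normalizers -/

/-- The action of `G` on the free group on `G ⧸ H` permuting the free generators. -/
def freeGroupCosetAction {G : Type*} [Group G] (H : Subgroup G) :
    G →* MulAut (FreeGroup (G ⧸ H)) where
  toFun g := FreeGroup.freeGroupCongr (MulAction.toPerm g)
  map_one' := by
    apply MulEquiv.toMonoidHom_injective
    ext x
    simp
  map_mul' g h := by
    apply MulEquiv.toMonoidHom_injective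
    ext x
    simp [mul_smul]

@[simp]
theorem freeGroupCosetAction_of {G : Type*} [Group G] (H : Subgroup G) (g : G) (x : G ⧸ H) :
    freeGroupCosetAction H g (FreeGroup.of x) = FreeGroup.of (g • x) := by
  simp [freeGroupCosetAction]

theorem mem_specialSubgroup_starOf_of_commute {Γ : SimpleGraph V} {t : V} {g : RAAG Γ}
    (hg : Commute g (raagGen Γ t)) : g ∈ SpecialSubgroup Γ (starOf Γ t) := by
  classical
  set H := SpecialSubgroup Γ (lk Γ t) with hH
  set r := raagRetraction Γ ({t}ᶜ) with hr
  have hrH : ∀ h ∈ H, r h = h := fun h hh =>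
    raagRetraction_eq_self (SpecialSubgroup.mono (fun a ha => by
      rintro rfl
      exact Γ.irrefl ha) hh)
  have hHt : ∀ h ∈ H, Commute h (raagGen Γ t) := by
    intro h hh
    have : H ≤ Subgroup.centralizer {raagGen Γ t} := by
      rw [hH, SpecialSubgroup, Subgroup.closure_le]
      rintro _ ⟨a, ha, rfl⟩
      exact Subgroup.mem_centralizer_singleton_iff.2 (raagGen_commute_s6 ha).symm.eq
    exact Subgroup.mem_centralizer_singleton_iff.1 (this hh)
  let x₀ : FreeGroup (RAAG Γ ⧸ H) := FreeGroup.of ((1 : RAAG Γ) : RAAG Γ ⧸ H)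
  have hx₀ : ∀ h ∈ H, freeGroupCosetAction H h x₀ = x₀ := by
    intro h hh
    simp only [x₀, freeGroupCosetAction_of]
    congr 1
    rw [MulAction.Quotient.smul_coe, smul_eq_mul, mul_one]
    exact QuotientGroup.eq.2 (by simpa using hh)
  have hcomm : ∀ h ∈ H, Commute (SemidirectProduct.inl x₀ : FreeGroup (RAAG Γ ⧸ H) ⋊[freeGroupCosetAction H] RAAG Γ)
      (SemidirectProduct.inr h) := by
    intro h hh
    have := SemidirectProduct.inl_aut (φ := freeGroupCosetAction H) h x₀
    rw [hx₀ h hh, map_inv, eq_mul_inv_iff_mul_eq] at this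
    exact this
  let ρ : RAAG Γ →* FreeGroup (RAAG Γ ⧸ H) ⋊[freeGroupCosetAction H] RAAG Γ := RAAG.lift Γ
    (fun a => if a = t then SemidirectProduct.inl x₀ else SemidirectProduct.inr (raagGen Γ a)) (by
      intro a b hab
      by_cases ha : a = t <;> by_cases hb : b = t
      · simp [ha, hb]
      · subst ha
        simpa [hb] using hcomm _ (raagGen_mem hab)
      · subst hb
        simpa [ha] using (hcomm _ (raagGen_mem hab.symm)).symm
      · simpa [ha, hb] using (raagGen_commute_s6 hab).map SemidirectProduct.inr)
  let conjT : RAAG Γ ⧸ H → RAAG Γ := fun q => Quotient.liftOn' q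
    (fun b => r b * raagGen Γ t * (r b)⁻¹) (by
      intro a b hab
      have hab' : a⁻¹ * b ∈ H := QuotientGroup.leftRel_apply.1 hab
      obtain ⟨h, hh, rfl⟩ : ∃ h ∈ H, b = a * h := ⟨_, hab', by group⟩
      simp only [map_mul, hrH h hh, mul_inv_rev, mul_assoc]
      rw [← mul_assoc h, (hHt h hh).eq]
      group)
  let σ : FreeGroup (RAAG Γ ⧸ H) ⋊[freeGroupCosetAction H] RAAG Γ →* RAAG Γ :=
    SemidirectProduct.lift (FreeGroup.lift conjT) r (by
    intro b
    ext q
    induction q using QuotientGroup.induction_on with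
    | H a =>
      simp [conjT, mul_assoc])
  have hσρ : ∀ x, σ (ρ x) = x := by
    have : σ.comp ρ = MonoidHom.id _ := by
      apply RAAG.hom_ext
      intro a
      by_cases ha : a = t
      · subst ha
        simp [σ, ρ, x₀, conjT]
      · simp [σ, ρ, ha, hr, raagRetraction_of_mem (show a ∈ ({t}ᶜ : Set V) from ha)]
    exact fun x => DFunLike.congr_fun this x
  have hρt : ρ (raagGen Γ t) = SemidirectProduct.inl x₀ := by simp [ρ]
  have hρg : ρ g * SemidirectProduct.inl x₀ = SemidirectProduct.inl x₀ * ρ g := by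
    rw [← hρt, ← map_mul, ← map_mul, hg.eq]
  have hleft := congrArg SemidirectProduct.left hρg
  simp only [SemidirectProduct.mul_left, SemidirectProduct.left_inl, SemidirectProduct.right_inl,
    map_one, MulAut.one_apply] at hleft
  set n := (ρ g).left
  set b := (ρ g).right
  have hb : b ∈ H := by
    simp only [x₀, freeGroupCosetAction_of] at hleft
    have := FreeGroup.of_eq_of_mul_of_eq hleft
    rw [MulAction.Quotient.smul_coe, smul_eq_mul, mul_one] at this
    exact by simpa using QuotientGroup.eq.1 this
  rw [hx₀ b hb] at hleft
  obtain ⟨k, hk⟩ := FreeGroup.mem_zpowers_of_commute _ n hleft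
  have hfin : g = raagGen Γ t ^ k * b := by
    rw [← hσρ g, ← SemidirectProduct.inl_left_mul_inr_right (ρ g)]
    change σ (SemidirectProduct.inl n * SemidirectProduct.inr b) = _
    rw [← hk]
    simp [σ, conjT, hrH b hb]
  rw [hfin]
  exact mul_mem (zpow_mem (raagGen_mem (Set.mem_insert _ _)) k)
    (SpecialSubgroup.mono (Set.subset_insert _ _) hb)

/-- A special subgroup `A_Θ` with `Θ⊥ ⊆ Θ` is self-normalizing. -/
theorem mem_specialSubgroup_of_conj_mem [Finite V] {Γ : SimpleGraph V} {Θ : Set V}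
    (hΘ : perp Γ Θ ⊆ Θ) {g : RAAG Γ}
    (hg : ∀ a ∈ Θ, g * raagGen Γ a * g⁻¹ ∈ SpecialSubgroup Γ Θ) :
    g ∈ SpecialSubgroup Γ Θ := by
  set r := raagRetraction Γ Θ
  have key : (r g)⁻¹ * g ∈ SpecialSubgroup Γ (perp Γ Θ) := by
    refine SpecialSubgroup.mem_iInter (Set.toFinite Θ) fun a ha => ?_
    apply mem_specialSubgroup_starOf_of_commute
    have h := raagRetraction_eq_self (hg a ha)
    rw [map_mul, map_mul, map_inv, raagRetraction_of_mem ha] at h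
    change r g * raagGen Γ a * (r g)⁻¹ = _ at h
    have h' : g * raagGen Γ a = r g * raagGen Γ a * (r g)⁻¹ * g := by
      rw [h, inv_mul_cancel_right]
    rw [Commute, SemiconjBy, mul_assoc, h']
    group
  have := mul_mem (raagRetraction_mem Γ Θ g) (SpecialSubgroup.mono hΘ key)
  rwa [mul_inv_cancel_left] at this

theorem mem_perp {Γ : SimpleGraph V} {Θ : Set V} {a : V} :
    a ∈ perp Γ Θ ↔ ∀ x ∈ Θ, a ∈ starOf Γ x := by
  simp [perp]

theorem mem_starOf_comm {Γ : SimpleGraph V} {a b : V} : a ∈ starOf Γ b ↔ b ∈ starOf Γ a := by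
  simp [starOf, eq_comm, Γ.adj_comm]

theorem self_mem_joinOf (Γ : SimpleGraph V) (v : V) : v ∈ JoinOf Γ v :=
  Or.inr (mem_perp.2 fun _ hx => Or.inr (Γ.adj_symm hx))

theorem perp_joinOf_subset (Γ : SimpleGraph V) (v : V) : perp Γ (JoinOf Γ v) ⊆ JoinOf Γ v :=
  fun _ ha => Or.inr (mem_perp.2 fun x hx => mem_perp.1 ha x (Or.inl hx))

/-! ### Automorphisms preserving a special subgroup -/

open scoped Pointwise

theorem mem_stabilizer_specialSubgroup_iff {Γ : SimpleGraph V} {Θ : Set V}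
    {φ : MulAut (RAAG Γ)} :
    φ ∈ MulAction.stabilizer (MulAut (RAAG Γ)) (SpecialSubgroup Γ Θ) ↔
      (SpecialSubgroup Γ Θ).map φ.toMonoidHom = SpecialSubgroup Γ Θ :=
  Iff.rfl

theorem mem_stabilizer_specialSubgroup {Γ : SimpleGraph V} {Θ : Set V} {φ : MulAut (RAAG Γ)}
    (h₁ : ∀ a ∈ Θ, φ (raagGen Γ a) ∈ SpecialSubgroup Γ Θ)
    (h₂ : ∀ a ∈ Θ, ∃ y ∈ SpecialSubgroup Γ Θ, φ y = raagGen Γ a) :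
    φ ∈ MulAction.stabilizer (MulAut (RAAG Γ)) (SpecialSubgroup Γ Θ) := by
  rw [mem_stabilizer_specialSubgroup_iff]
  apply le_antisymm
  · rw [Subgroup.map_le_iff_le_comap]
    nth_rw 1 [SpecialSubgroup]
    rw [Subgroup.closure_le]
    rintro _ ⟨a, ha, rfl⟩
    exact h₁ a ha
  · nth_rw 1 [SpecialSubgroup]
    rw [Subgroup.closure_le]
    rintro _ ⟨a, ha, rfl⟩
    exact h₂ a ha

theorem mem_stabilizer_of_fixes {Γ : SimpleGraph V} {Θ : Set V} {φ : MulAut (RAAG Γ)}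
    (h : ∀ a ∈ Θ, φ (raagGen Γ a) = raagGen Γ a) :
    φ ∈ MulAction.stabilizer (MulAut (RAAG Γ)) (SpecialSubgroup Γ Θ) :=
  mem_stabilizer_specialSubgroup (fun a ha => (h a ha).symm ▸ raagGen_mem ha)
    fun a ha => ⟨_, raagGen_mem ha, h a ha⟩

theorem conj_mem_stabilizer {Γ : SimpleGraph V} {Θ : Set V} {g : RAAG Γ}
    (hg : g ∈ SpecialSubgroup Γ Θ) :
    MulAut.conj g ∈ MulAction.stabilizer (MulAut (RAAG Γ)) (SpecialSubgroup Γ Θ) := by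
  refine mem_stabilizer_specialSubgroup (fun a ha => ?_) fun a ha => ?_
  · exact mul_mem (mul_mem hg (raagGen_mem ha)) (inv_mem hg)
  · refine ⟨g⁻¹ * raagGen Γ a * g, mul_mem (mul_mem (inv_mem hg) (raagGen_mem ha)) hg, ?_⟩
    simp [mul_assoc]

theorem mem_of_conj_mem_stabilizer [Finite V] {Γ : SimpleGraph V} {Θ : Set V}
    (hΘ : perp Γ Θ ⊆ Θ) {g : RAAG Γ}
    (hg : MulAut.conj g ∈ MulAction.stabilizer (MulAut (RAAG Γ)) (SpecialSubgroup Γ Θ)) :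
    g ∈ SpecialSubgroup Γ Θ := by
  rw [mem_stabilizer_specialSubgroup_iff] at hg
  exact mem_specialSubgroup_of_conj_mem hΘ fun a ha =>
    hg.le ⟨raagGen Γ a, raagGen_mem ha, rfl⟩

theorem IsInversionAt.mem_stabilizer {Γ : SimpleGraph V} {φ : MulAut (RAAG Γ)} {u : V}
    (h : IsInversionAt Γ φ u) (Θ : Set V) :
    φ ∈ MulAction.stabilizer (MulAut (RAAG Γ)) (SpecialSubgroup Γ Θ) := by
  refine mem_stabilizer_specialSubgroup (fun a ha => ?_) fun a ha => ?_
  · by_cases hau : a = u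
    · subst hau
      exact h.1.symm ▸ inv_mem (raagGen_mem ha)
    · exact (h.2 a hau).symm ▸ raagGen_mem ha
  · by_cases hau : a = u
    · subst hau
      exact ⟨_, inv_mem (raagGen_mem ha), by rw [map_inv, h.1, inv_inv]⟩
    · exact ⟨_, raagGen_mem ha, h.2 a hau⟩

theorem mem_joinOf_of_lk_subset_starOf {Γ : SimpleGraph V} {a u v : V}
    (h : lk Γ a ⊆ starOf Γ u) (ha : a ∈ JoinOf Γ v) : u ∈ JoinOf Γ v := by
  by_cases hav : a ∈ lk Γ v
  · rcases h (Γ.adj_symm hav : v ∈ lk Γ a) with rfl | hu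
    · exact self_mem_joinOf Γ _
    · exact Or.inl (Γ.adj_symm hu)
  · refine Or.inr (mem_perp.2 fun x hx => mem_starOf_comm.1 (h ?_))
    rcases mem_perp.1 (ha.resolve_left hav) x hx with rfl | hax
    · exact absurd hx hav
    · exact Γ.adj_symm hax

theorem IsTransvection.mem_stabilizer {Γ : SimpleGraph V} {φ : MulAut (RAAG Γ)} {a u : V}
    (h : IsTransvection Γ φ a u) (v : V) :
    φ ∈ MulAction.stabilizer (MulAut (RAAG Γ)) (SpecialSubgroup Γ (JoinOf Γ v)) := by
  obtain ⟨hne, hlk, hφa, hφ⟩ := h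
  have hu : a ∈ JoinOf Γ v → raagGen Γ u ∈ SpecialSubgroup Γ (JoinOf Γ v) := fun ha =>
    raagGen_mem (mem_joinOf_of_lk_subset_starOf hlk ha)
  refine mem_stabilizer_specialSubgroup (fun b hb => ?_) fun b hb => ?_
  · by_cases hba : b = a
    · subst hba
      exact hφa.symm ▸ mul_mem (raagGen_mem hb) (hu hb)
    · exact (hφ b hba).symm ▸ raagGen_mem hb
  · by_cases hba : b = a
    · subst hba
      exact ⟨_, mul_mem (raagGen_mem hb) (inv_mem (hu hb)), by
        rw [map_mul, map_inv, hφa, hφ u hne, mul_inv_cancel_right]⟩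
    · exact ⟨_, raagGen_mem hb, hφ b hba⟩

theorem notMem_starOf_of_notMem_joinOf {Γ : SimpleGraph V} {u v : V} (h : u ∉ JoinOf Γ v) :
    v ∉ starOf Γ u := by
  rintro (rfl | hu)
  · exact h (self_mem_joinOf Γ _)
  · exact h (Or.inl (Γ.adj_symm hu))

theorem IsComponentOf.mem_iff_of_adj {Γ : SimpleGraph V} {S C : Set V} (hC : IsComponentOf Γ S C)
    {x y : V} (hx : x ∈ S) (hy : y ∈ S) (hxy : Γ.Adj x y) : x ∈ C ↔ y ∈ C :=
  ⟨fun h => hC.2.2.2 x h y hy hxy, fun h => hC.2.2.2 y h x hx hxy.symm⟩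

/-- If `u ∉ J_v`, then all of `J_v ∖ st(u)` lies in the component of `Γ ∖ st(u)` containing `v`. -/
theorem IsComponentOf.mem_iff_of_mem_joinOf {Γ : SimpleGraph V} {u v : V} {C : Set V}
    (hC : IsComponentOf Γ (starOf Γ u)ᶜ C) (hu : u ∉ JoinOf Γ v) {y : V} (hy : y ∈ JoinOf Γ v)
    (hyu : y ∉ starOf Γ u) : y ∈ C ↔ v ∈ C := by
  have hv : v ∈ (starOf Γ u)ᶜ := notMem_starOf_of_notMem_joinOf hu
  rcases hy with hy | hy
  · exact (hC.mem_iff_of_adj hv hyu hy).symm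
  · obtain ⟨x, hx, hxu⟩ : ∃ x ∈ lk Γ v, u ∉ starOf Γ x := by
      by_contra! hcon
      exact hu (Or.inr (mem_perp.2 hcon))
    have hxu' : x ∈ (starOf Γ u)ᶜ := fun h => hxu (mem_starOf_comm.1 h)
    have hxv : v ∈ C ↔ x ∈ C := hC.mem_iff_of_adj hv hxu' hx
    rcases mem_perp.1 hy x hx with rfl | hyx
    · exact hxv.symm
    · rw [hxv]
      exact (hC.mem_iff_of_adj hxu' hyu hyx).symm

theorem IsPartialConjBy.mem_stabilizer_of_mem {Γ : SimpleGraph V} {φ : MulAut (RAAG Γ)} {u : V}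
    {C Θ : Set V} (hC : C ⊆ (starOf Γ u)ᶜ) (h : IsPartialConjBy Γ φ u C) (hu : u ∈ Θ) :
    φ ∈ MulAction.stabilizer (MulAut (RAAG Γ)) (SpecialSubgroup Γ Θ) := by
  have hU : raagGen Γ u ∈ SpecialSubgroup Γ Θ := raagGen_mem hu
  have hφu : φ (raagGen Γ u) = raagGen Γ u := h.2 u fun huC => hC huC (Set.mem_insert _ _)
  refine mem_stabilizer_specialSubgroup (fun a ha => ?_) fun a ha => ?_
  · by_cases haC : a ∈ C
    · exact (h.1 a haC).symm ▸ mul_mem (mul_mem (inv_mem hU) (raagGen_mem ha)) hU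
    · exact (h.2 a haC).symm ▸ raagGen_mem ha
  · by_cases haC : a ∈ C
    · refine ⟨_, mul_mem (mul_mem hU (raagGen_mem ha)) (inv_mem hU), ?_⟩
      rw [map_mul, map_mul, map_inv, h.1 a haC, hφu]
      group
    · exact ⟨_, raagGen_mem ha, h.2 a haC⟩

/-- If `u ∉ J_v` and `v ∉ C`, the partial conjugation of `C` by `u` preserves `A_{J_v}`. -/
theorem IsPartialConjBy.mem_stabilizer_of_notMem {Γ : SimpleGraph V} {φ : MulAut (RAAG Γ)}
    {u v : V} {C : Set V} (hC : IsComponentOf Γ (starOf Γ u)ᶜ C) (h : IsPartialConjBy Γ φ u C)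
    (hu : u ∉ JoinOf Γ v) (hv : v ∉ C) :
    φ ∈ MulAction.stabilizer (MulAut (RAAG Γ)) (SpecialSubgroup Γ (JoinOf Γ v)) :=
  mem_stabilizer_of_fixes fun a ha => h.2 a fun haC =>
    hv ((hC.mem_iff_of_mem_joinOf hu ha (hC.1 haC)).1 haC)

/-- If `u ∉ J_v` and `v ∈ C`, the partial conjugation of `C` by `u`, followed by conjugation
by `u`, preserves `A_{J_v}`. -/
theorem IsPartialConjBy.conj_mul_mem_stabilizer {Γ : SimpleGraph V} {φ : MulAut (RAAG Γ)}
    {u v : V} {C : Set V} (hC : IsComponentOf Γ (starOf Γ u)ᶜ C) (h : IsPartialConjBy Γ φ u C)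
    (hu : u ∉ JoinOf Γ v) (hv : v ∈ C) :
    MulAut.conj (raagGen Γ u) * φ ∈
      MulAction.stabilizer (MulAut (RAAG Γ)) (SpecialSubgroup Γ (JoinOf Γ v)) := by
  refine mem_stabilizer_of_fixes fun a ha => ?_
  rw [MulAut.mul_apply, MulAut.conj_apply]
  by_cases haC : a ∈ C
  · rw [h.1 a haC]
    group
  · have hau : a ∈ starOf Γ u := by
      by_contra hau
      exact haC ((hC.mem_iff_of_mem_joinOf hu ha hau).2 hv)
    rw [h.2 a haC, (raagGen_commute_of_mem_starOf hau).eq, mul_inv_cancel_right]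

theorem IsPartialConjBy.exists_conj_mul_mem_stabilizer {Γ : SimpleGraph V}
    {φ : MulAut (RAAG Γ)} {u v w : V} {C : Set V} (hvw : Γ.Adj v w)
    (hC : IsComponentOf Γ (starOf Γ u)ᶜ C) (h : IsPartialConjBy Γ φ u C) :
    ∃ g : RAAG Γ, MulAut.conj g * φ ∈
      MulAction.stabilizer (MulAut (RAAG Γ)) (SpecialSubgroup Γ (JoinOf Γ v)) ⊓
      MulAction.stabilizer (MulAut (RAAG Γ)) (SpecialSubgroup Γ (JoinOf Γ w)) := by
  have hmem : ∀ x, u ∈ JoinOf Γ x →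
      φ ∈ MulAction.stabilizer (MulAut (RAAG Γ)) (SpecialSubgroup Γ (JoinOf Γ x)) :=
    fun x hx => h.mem_stabilizer_of_mem hC.1 hx
  have hmem' : ∀ x, u ∈ JoinOf Γ x → MulAut.conj (raagGen Γ u) * φ ∈
      MulAction.stabilizer (MulAut (RAAG Γ)) (SpecialSubgroup Γ (JoinOf Γ x)) :=
    fun x hx => mul_mem (conj_mem_stabilizer (raagGen_mem hx)) (hmem x hx)
  have hiff : u ∉ JoinOf Γ v → u ∉ JoinOf Γ w → (v ∈ C ↔ w ∈ C) := fun hv hw =>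
    hC.mem_iff_of_adj (notMem_starOf_of_notMem_joinOf hv) (notMem_starOf_of_notMem_joinOf hw) hvw
  by_cases hcase : (u ∈ JoinOf Γ v ∨ v ∈ C) ∧ (u ∈ JoinOf Γ w ∨ w ∈ C)
  · have aux : ∀ x, (u ∈ JoinOf Γ x ∨ x ∈ C) → MulAut.conj (raagGen Γ u) * φ ∈
        MulAction.stabilizer (MulAut (RAAG Γ)) (SpecialSubgroup Γ (JoinOf Γ x)) := by
      intro x hx
      by_cases hux : u ∈ JoinOf Γ x
      · exact hmem' x hux
      · exact h.conj_mul_mem_stabilizer hC hux (hx.resolve_left hux)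
    exact ⟨_, aux v hcase.1, aux w hcase.2⟩
  · have aux : ∀ x, (u ∈ JoinOf Γ x ∨ x ∉ C) →
        φ ∈ MulAction.stabilizer (MulAut (RAAG Γ)) (SpecialSubgroup Γ (JoinOf Γ x)) := by
      intro x hx
      by_cases hux : u ∈ JoinOf Γ x
      · exact hmem x hux
      · exact h.mem_stabilizer_of_notMem hC hux (hx.resolve_left hux)
    refine ⟨1, ?_⟩
    rw [map_one, one_mul]
    exact ⟨aux v (by tauto), aux w (by tauto)⟩

/-- For adjacent `v, w`, every element of `Aut⁰(A_Γ)` agrees, up to an inner automorphism, with one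
preserving both `A_{J_v}` and `A_{J_w}`. -/
theorem Aut0_le_stabilizer_sup_Inn {Γ : SimpleGraph V} {v w : V} (hvw : Γ.Adj v w) :
    Aut0 Γ ≤ (MulAction.stabilizer (MulAut (RAAG Γ)) (SpecialSubgroup Γ (JoinOf Γ v)) ⊓
      MulAction.stabilizer (MulAut (RAAG Γ)) (SpecialSubgroup Γ (JoinOf Γ w))) ⊔
      Inn (RAAG Γ) := by
  rw [Aut0, Subgroup.closure_le]
  rintro φ (((hφ | ⟨u, hφ⟩) | ⟨u, C, hC, hφ⟩) | ⟨a, u, hφ⟩)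
  · exact Subgroup.mem_sup_right hφ
  · exact Subgroup.mem_sup_left ⟨hφ.mem_stabilizer _, hφ.mem_stabilizer _⟩
  · obtain ⟨g, hg⟩ := hφ.exists_conj_mul_mem_stabilizer hvw hC
    have := mul_mem (Subgroup.mem_sup_right (inv_mem (⟨g, rfl⟩ : MulAut.conj g ∈ Inn _)))
      (Subgroup.mem_sup_left (T := Inn (RAAG Γ)) hg)
    rwa [inv_mul_cancel_left] at this
  · exact Subgroup.mem_sup_left ⟨hφ.mem_stabilizer _, hφ.mem_stabilizer _⟩

/-- If `v, w` are interior vertices joined by an edge and `φ_v, φ_w ∈ Aut⁰(A_Γ)`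
represent the same outer class and preserve `A_{J_v}`, `A_{J_w}` respectively, then
`c(g_v) ∘ φ_v = c(g_w) ∘ φ_w` for some `g_v ∈ A_{J_v}`, `g_w ∈ A_{J_w}`. -/
theorem edge_representatives {V : Type*} [Fintype V] (Γ : SimpleGraph V)
    (hconn : Γ.Connected) (htf : Γ.CliqueFree 3) (hE : 2 ≤ Γ.edgeSet.ncard)
    (v w : V) (hv : ¬ IsLeaf Γ v) (hw : ¬ IsLeaf Γ w) (hvw : Γ.Adj v w)
    (φv φw : MulAut (RAAG Γ)) (hφv : φv ∈ Aut0 Γ) (hφw : φw ∈ Aut0 Γ)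
    (hsame : QuotientGroup.mk' (Inn (RAAG Γ)) φv = QuotientGroup.mk' (Inn (RAAG Γ)) φw)
    (hpv : (SpecialSubgroup Γ (JoinOf Γ v)).map φv.toMonoidHom
        = SpecialSubgroup Γ (JoinOf Γ v))
    (hpw : (SpecialSubgroup Γ (JoinOf Γ w)).map φw.toMonoidHom
        = SpecialSubgroup Γ (JoinOf Γ w)) :
    ∃ gv ∈ SpecialSubgroup Γ (JoinOf Γ v), ∃ gw ∈ SpecialSubgroup Γ (JoinOf Γ w),
      MulAut.conj gv * φv = MulAut.conj gw * φw := by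
  obtain ⟨ψ, hψ, ι, ⟨k, rfl⟩, rfl⟩ :=
    Subgroup.mem_sup_of_normal_right.1 (Aut0_le_stabilizer_sup_Inn hvw hφv)
  obtain ⟨m, hm⟩ : (ψ * MulAut.conj k)⁻¹ * φw ∈ Inn (RAAG Γ) := QuotientGroup.eq.1 hsame
  have hconj : ∀ g, ψ * MulAut.conj g = MulAut.conj (ψ g) * ψ := by
    intro g
    ext x
    simp
  have hφw' : φw = MulAut.conj (ψ (k * m)) * ψ := by
    rw [← hconj, map_mul, ← mul_assoc, hm, mul_inv_cancel_left]
  rw [hconj] at hpv ⊢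
  subst hφw'
  rw [← mem_stabilizer_specialSubgroup_iff] at hpv hpw
  have hgv := mem_of_conj_mem_stabilizer (perp_joinOf_subset Γ v)
    ((Subgroup.mul_mem_cancel_right _ hψ.1).1 hpv)
  have hgw := mem_of_conj_mem_stabilizer (perp_joinOf_subset Γ w)
    ((Subgroup.mul_mem_cancel_right _ hψ.2).1 hpw)
  refine ⟨_, inv_mem hgv, _, inv_mem hgw, ?_⟩
  rw [map_inv, map_inv, inv_mul_cancel_left, inv_mul_cancel_left]
end
end
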